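/- arXiv:1907.08545 — 2 statements merged into one kernel-verified Lean document; each statement's English description precedes it below -/
import Mathlib

section
/- Let 1 ≤ c ≤ n−1 and let X ⊆ ℂ^n be positively hyperbolic of codimension c. Then each of the following sets is also positively hyperbolic of codimension c: (i) {(a_1 x_1, …, a_n x_n) : x ∈ X} for any positive reals a_1, …, a_n; (ii) the cyclic shift {((−1)^{c−1} x_n, x_1, …, x_{n−1}) : x ∈ X}; (iii) the reversal {(x_n, x_{n−1}, …, x_1) : x ∈ X}; (iv) the negation {(−x_1, …, −x_n) : x ∈ X}; (v) for any i ∈ [n], the coordinate inversion {(x_1, …, x_{i−1}, −x_i^{−1}, x_{i+1}, …, x_n) : x ∈ X, x_i ≠ 0}. -/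
open Matrix

/-- All maximal (`c × c`) minors of a `c × n` real matrix are positive. -/
def AllMinorsPos {c n : ℕ} (A : Matrix (Fin c) (Fin n) ℝ) : Prop :=
  ∀ s : Fin c → Fin n, StrictMono s → 0 < (A.submatrix id s).det

/-- All maximal (`c × c`) minors of a `c × n` real matrix are nonnegative. -/
def AllMinorsNonneg {c n : ℕ} (A : Matrix (Fin c) (Fin n) ℝ) : Prop :=
  ∀ s : Fin c → Fin n, StrictMono s → 0 ≤ (A.submatrix id s).det

/-- A `c`-dimensional linear subspace of `ℝⁿ` is positive if it is the row space of a real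
`c × n` matrix of rank `c` all of whose `c × c` minors are positive. -/
def IsPositiveSubspace {n : ℕ} (c : ℕ) (L : Submodule ℝ (Fin n → ℝ)) : Prop :=
  ∃ A : Matrix (Fin c) (Fin n) ℝ, A.rank = c ∧
    L = Submodule.span ℝ (Set.range fun i => A i) ∧ AllMinorsPos A

/-- A `c`-dimensional linear subspace of `ℝⁿ` is nonnegative if it is the row space of a real
`c × n` matrix of rank `c` all of whose `c × c` minors are nonnegative. -/
def IsNonnegSubspace {n : ℕ} (c : ℕ) (L : Submodule ℝ (Fin n → ℝ)) : Prop :=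
  ∃ A : Matrix (Fin c) (Fin n) ℝ, A.rank = c ∧
    L = Submodule.span ℝ (Set.range fun i => A i) ∧ AllMinorsNonneg A

/-- Coordinatewise imaginary part of a point of `ℂⁿ`. -/
def imPart {n : ℕ} (x : Fin n → ℂ) : Fin n → ℝ := fun i => (x i).im

/-- A subset of `ℂⁿ` is positively hyperbolic of codimension `c` if the imaginary part of any
of its points does not lie in `L \ {0}` for any positive `c`-dimensional subspace `L ⊆ ℝⁿ`. -/
def PosHyperbolic {n : ℕ} (c : ℕ) (X : Set (Fin n → ℂ)) : Prop :=
  ∀ L : Submodule ℝ (Fin n → ℝ), IsPositiveSubspace c L →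
    ∀ x ∈ X, ¬ (imPart x ∈ L ∧ imPart x ≠ 0)

/-- The linear endomorphism of `ℝⁿ` sending `v` to the vector with `k`-th entry
`w k * v (e k)`. -/
def weightedReindex {n : ℕ} (w : Fin n → ℝ) (e : Fin n → Fin n) :
    (Fin n → ℝ) →ₗ[ℝ] (Fin n → ℝ) where
  toFun v k := w k * v (e k)
  map_add' u v := by ext k; simp [mul_add]
  map_smul' r v := by ext k; simp [mul_left_comm]

lemma weightedReindex_apply {n : ℕ} (w : Fin n → ℝ) (e : Fin n → Fin n) (v : Fin n → ℝ)
    (k : Fin n) : weightedReindex w e v k = w k * v (e k) := rfl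

/-- A matrix with positive maximal minors has full rank, so its row space is positive. -/
lemma AllMinorsPos.isPositiveSubspace {c n : ℕ} (hcn : c ≤ n) {A : Matrix (Fin c) (Fin n) ℝ}
    (hA : AllMinorsPos A) :
    IsPositiveSubspace c (Submodule.span ℝ (Set.range fun i => A i)) := by
  refine ⟨A, ?_, rfl, hA⟩
  have hdet := hA (Fin.castLE hcn) (Fin.strictMono_castLE hcn)
  have hunit : IsUnit (A.submatrix id (Fin.castLE hcn)) :=
    (Matrix.isUnit_iff_isUnit_det _).2 hdet.ne'.isUnit
  have hrank := Matrix.rank_of_isUnit _ hunit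
  rw [Fintype.card_fin] at hrank
  refine le_antisymm ((Matrix.rank_le_card_height A).trans_eq (Fintype.card_fin c)) ?_
  exact hrank.ge.trans (Matrix.rank_submatrix_le _ _ _)

/-- Positive hyperbolicity transfers along linear maps which, up to a permutation of the rows,
preserve positivity of the maximal minors. -/
lemma PosHyperbolic.of_linearMap {c n : ℕ} (hcn : c ≤ n) {X Y : Set (Fin n → ℂ)}
    (hX : PosHyperbolic c X)
    (h : ∀ y ∈ Y, ∃ x ∈ X, ∃ φ : (Fin n → ℝ) →ₗ[ℝ] (Fin n → ℝ), φ (imPart y) = imPart x ∧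
      (imPart x = 0 → imPart y = 0) ∧
      ∀ A : Matrix (Fin c) (Fin n) ℝ, AllMinorsPos A →
        ∃ ρ : Equiv.Perm (Fin c), AllMinorsPos (Matrix.of fun i => φ (A (ρ i)))) :
    PosHyperbolic c Y := by
  rintro L ⟨A, -, rfl, hA⟩ y hy ⟨hyL, hy0⟩
  obtain ⟨x, hx, φ, hφ, h0, hmin⟩ := h y hy
  obtain ⟨ρ, hρ⟩ := hmin A hA
  refine hX _ (hρ.isPositiveSubspace hcn) x hx ⟨?_, fun hx0 => hy0 (h0 hx0)⟩
  have hmem := Submodule.mem_map_of_mem (f := φ) hyL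
  rw [hφ, Submodule.map_span] at hmem
  refine Submodule.span_mono ?_ hmem
  rintro _ ⟨_, ⟨i, rfl⟩, rfl⟩
  exact ⟨ρ.symm i, congrArg (fun j => φ (A j)) (ρ.apply_symm_apply i)⟩

lemma AllMinorsPos.scale {c n : ℕ} {A : Matrix (Fin c) (Fin n) ℝ} (hA : AllMinorsPos A)
    {w : Fin n → ℝ} (hw : ∀ i, 0 < w i) :
    AllMinorsPos (Matrix.of fun i => weightedReindex w id (A i)) := by
  intro s hs
  have hdet := Matrix.det_mul_row (fun k => w (s k)) (A.submatrix id s)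
  have hprod : 0 < ∏ k, w (s k) := Finset.prod_pos fun k _ => hw (s k)
  exact (mul_pos hprod (hA s hs)).trans_eq hdet.symm

lemma AllMinorsPos.reverse {c n : ℕ} {A : Matrix (Fin c) (Fin n) ℝ} (hA : AllMinorsPos A) :
    AllMinorsPos (Matrix.of fun i => weightedReindex 1 Fin.rev (A (Fin.revPerm i))) := by
  intro s hs
  have hmono : StrictMono fun k : Fin c => (s k.rev).rev := fun a b hab =>
    Fin.rev_lt_rev.2 (hs (Fin.rev_lt_rev.2 hab))
  have hdet := Matrix.det_submatrix_equiv_self Fin.revPerm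
    (A.submatrix id fun k => (s k.rev).rev)
  refine (hA _ hmono).trans_eq (hdet.symm.trans (congrArg Matrix.det ?_))
  ext i j
  simp [weightedReindex_apply]

/-- The weights of the inverse signed cyclic shift: `(-1)^d` in the last coordinate, and `1`
elsewhere. -/
def shiftWeight (d m : ℕ) (k : Fin (m + 1)) : ℝ := if k = Fin.last m then (-1) ^ d else 1

lemma AllMinorsPos.cyclicShift {d m : ℕ} {A : Matrix (Fin (d + 1)) (Fin (m + 1)) ℝ}
    (hA : AllMinorsPos A) :
    AllMinorsPos
      (Matrix.of fun i => weightedReindex (shiftWeight d m) (finRotate (m + 1)) (A i)) := by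
  intro s hs
  by_cases hlast : s (Fin.last d) = Fin.last m
  · have hne : ∀ k : Fin d, s k.castSucc ≠ Fin.last m := fun k =>
      ((hs k.castSucc_lt_last).trans_le (Fin.le_last _)).ne
    set t : Fin (d + 1) → Fin (m + 1) :=
      fun k => finRotate (m + 1) (s ((finRotate (d + 1)).symm k)) with ht
    have htr : ∀ k, t (finRotate (d + 1) k) = finRotate (m + 1) (s k) := by simp [ht]
    have ht0 : t 0 = 0 := by
      have := htr (Fin.last d)
      rwa [hlast, finRotate_last, finRotate_last] at this
    have htsucc : ∀ k : Fin d, (t k.succ : ℕ) = s k.castSucc + 1 := by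
      intro k
      have := htr k.castSucc
      rw [finRotate_apply, Fin.coeSucc_eq_succ] at this
      rw [this, coe_finRotate_of_ne_last (hne k)]
    have htmono : StrictMono t := by
      intro a b hab
      obtain ⟨b, rfl⟩ := Fin.exists_succ_eq.2 (Fin.ne_zero_of_lt hab)
      rw [Fin.lt_def, htsucc]
      rcases Fin.eq_zero_or_eq_succ a with rfl | ⟨a, rfl⟩
      · simp [ht0]
      · rw [htsucc]
        have := Fin.lt_def.1 (hs (Fin.castSucc_lt_castSucc_iff.2 (Fin.succ_lt_succ_iff.1 hab)))
        omega
    have hprod : ∏ k, shiftWeight d m (s k) = (-1) ^ d := by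
      rw [Fin.prod_univ_castSucc]
      simp [shiftWeight, hlast, hne]
    have hperm := Matrix.det_permute' (finRotate (d + 1)) (A.submatrix id t)
    have hdet := Matrix.det_mul_row (fun k => shiftWeight d m (s k))
      ((A.submatrix id t).submatrix id (finRotate (d + 1)))
    rw [hperm, hprod, sign_finRotate] at hdet
    have hsq : ((-1 : ℝ) ^ d) * (-1) ^ d = 1 := by rw [← mul_pow]; simp
    push_cast at hdet
    rw [← mul_assoc, hsq, one_mul] at hdet
    refine (hA t htmono).trans_eq (hdet.symm.trans (congrArg Matrix.det ?_))
    ext i j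
    exact congrArg (fun k => shiftWeight d m (s j) * A i k) (htr j)
  · have hne : ∀ k, s k ≠ Fin.last m := fun k hk =>
      hlast (le_antisymm (Fin.le_last _) (hk ▸ hs.monotone (Fin.le_last k)))
    have hmono : StrictMono fun k => finRotate (m + 1) (s k) := by
      intro a b hab
      rw [Fin.lt_def, coe_finRotate_of_ne_last (hne a), coe_finRotate_of_ne_last (hne b)]
      exact Nat.succ_lt_succ (hs hab)
    refine (hA _ hmono).trans_eq (congrArg Matrix.det ?_)
    ext i j
    simp [weightedReindex_apply, shiftWeight, hne]

/-- A set whose points have imaginary parts that are positive coordinatewise rescalings (possibly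
depending on the point) of those of points of a positively hyperbolic set is positively
hyperbolic. -/
lemma PosHyperbolic.of_scale {c n : ℕ} (hcn : c ≤ n) {X Y : Set (Fin n → ℂ)}
    (hX : PosHyperbolic c X)
    (h : ∀ y ∈ Y, ∃ x ∈ X, ∃ w : Fin n → ℝ, (∀ i, 0 < w i) ∧ ∀ i, (y i).im = w i * (x i).im) :
    PosHyperbolic c Y := by
  refine hX.of_linearMap hcn fun y hy => ?_
  obtain ⟨x, hx, w, hw, hyx⟩ := h y hy
  refine ⟨x, hx, weightedReindex w⁻¹ id, ?_, fun h0 => ?_,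
    fun A hA => ⟨1, hA.scale fun i => inv_pos.2 (hw i)⟩⟩
  · ext i
    simp [weightedReindex_apply, imPart, hyx, (hw i).ne']
  · ext i
    have := congrFun h0 i
    simp_all [imPart]

lemma PosHyperbolic.reverse {c n : ℕ} (hcn : c ≤ n) {X : Set (Fin n → ℂ)}
    (hX : PosHyperbolic c X) :
    PosHyperbolic c ((fun x : Fin n → ℂ => fun i : Fin n => x i.rev) '' X) := by
  refine hX.of_linearMap hcn ?_
  rintro _ ⟨x, hx, rfl⟩
  refine ⟨x, hx, weightedReindex 1 Fin.rev, ?_, fun h0 => ?_,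
    fun A hA => ⟨Fin.revPerm, hA.reverse⟩⟩
  · ext i
    simp [weightedReindex_apply, imPart]
  · ext i
    exact congrFun h0 i.rev

lemma PosHyperbolic.neg {c n : ℕ} {X : Set (Fin n → ℂ)} (hX : PosHyperbolic c X) :
    PosHyperbolic c ((fun x : Fin n → ℂ => fun i => -(x i)) '' X) := by
  rintro L hL _ ⟨x, hx, rfl⟩ h
  have him : imPart (fun i => -(x i)) = -imPart x := by
    ext i
    simp [imPart]
  rw [him, neg_mem_iff, neg_ne_zero] at h
  exact hX L hL x hx h

lemma PosHyperbolic.cyclicShift {c n : ℕ} (hc1 : 1 ≤ c) (hcn : c ≤ n) {X : Set (Fin n → ℂ)}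
    (hX : PosHyperbolic c X) :
    PosHyperbolic c
      ((fun x : Fin n → ℂ => fun i : Fin n =>
        (if (i : ℕ) = 0 then ((-1 : ℂ)) ^ (c - 1) else 1) * x ((finRotate n).symm i)) '' X) := by
  obtain ⟨d, rfl⟩ := Nat.exists_eq_add_of_le' hc1
  obtain ⟨m, rfl⟩ := Nat.exists_eq_add_of_le' (hc1.trans hcn)
  have hsq : ((-1 : ℝ) ^ d) * (-1) ^ d = 1 := by rw [← mul_pow]; simp
  refine hX.of_linearMap hcn ?_
  rintro _ ⟨x, hx, rfl⟩
  have him : ∀ k, imPart (fun i : Fin (m + 1) =>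
      (if (i : ℕ) = 0 then ((-1 : ℂ)) ^ (d + 1 - 1) else 1) * x ((finRotate (m + 1)).symm i))
        (finRotate (m + 1) k) = shiftWeight d m k * imPart x k := by
    intro k
    by_cases hk : k = Fin.last m
    · subst hk
      have hpow : ((-1 : ℂ)) ^ d = (((-1 : ℝ) ^ d : ℝ) : ℂ) := by push_cast; rfl
      simp only [imPart, Equiv.symm_apply_apply, shiftWeight, Nat.add_sub_cancel, if_true]
      rw [if_pos (by rw [finRotate_last, Fin.val_zero]), hpow, Complex.im_ofReal_mul]
    · have hval : (finRotate (m + 1) k : ℕ) ≠ 0 := by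
        rw [coe_finRotate_of_ne_last hk]
        exact Nat.succ_ne_zero _
      simp only [imPart, Equiv.symm_apply_apply, shiftWeight, if_neg hk, if_neg hval, one_mul]
  refine ⟨x, hx, weightedReindex (shiftWeight d m) (finRotate (m + 1)), ?_, fun h0 => ?_,
    fun A hA => ⟨1, hA.cyclicShift⟩⟩
  · ext k
    rw [weightedReindex_apply, him, ← mul_assoc]
    by_cases hk : k = Fin.last m <;> simp [shiftWeight, hk, hsq]
  · ext i
    obtain ⟨k, rfl⟩ := (finRotate (m + 1)).surjective i
    rw [him, h0]
    simp

/-- Positive hyperbolicity of codimension `c` is preserved by: (i) positive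
coordinate scaling; (ii) the signed cyclic shift `x ↦ ((-1)^(c-1) xₙ, x₁, …, x_{n-1})`;
(iii) coordinate reversal; (iv) negation; (v) inversion `xᵢ ↦ -xᵢ⁻¹` in any one coordinate. -/
theorem stmt7 {n c : ℕ} (hc1 : 1 ≤ c) (hc2 : c ≤ n - 1) (X : Set (Fin n → ℂ))
    (hX : PosHyperbolic c X) :
    (∀ a : Fin n → ℝ, (∀ i, 0 < a i) →
      PosHyperbolic c ((fun x : Fin n → ℂ => fun i => (a i : ℂ) * x i) '' X)) ∧
    PosHyperbolic c
      ((fun x : Fin n → ℂ => fun i : Fin n =>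
        (if (i : ℕ) = 0 then ((-1 : ℂ)) ^ (c - 1) else 1) * x ((finRotate n).symm i)) '' X) ∧
    PosHyperbolic c ((fun x : Fin n → ℂ => fun i : Fin n => x i.rev) '' X) ∧
    PosHyperbolic c ((fun x : Fin n → ℂ => fun i => -(x i)) '' X) ∧
    (∀ i₀ : Fin n,
      PosHyperbolic c
        ((fun x : Fin n → ℂ => Function.update x i₀ (-(x i₀)⁻¹)) '' {x ∈ X | x i₀ ≠ 0})) := by
  have hcn : c ≤ n := hc2.trans (Nat.sub_le n 1)
  refine ⟨fun a ha => hX.of_scale hcn ?_, hX.cyclicShift hc1 hcn, hX.reverse hcn, hX.neg,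
    fun i₀ => hX.of_scale hcn ?_⟩
  · rintro _ ⟨x, hx, rfl⟩
    exact ⟨x, hx, a, ha, fun i => Complex.im_ofReal_mul _ _⟩
  · rintro _ ⟨x, ⟨hx, hx0⟩, rfl⟩
    refine ⟨x, hx, Function.update 1 i₀ (Complex.normSq (x i₀))⁻¹, fun i => ?_, fun i => ?_⟩
    · rcases eq_or_ne i i₀ with rfl | hi
      · simpa using hx0
      · simp [hi]
    · rcases eq_or_ne i i₀ with rfl | hi
      · simp [Complex.inv_im, div_eq_inv_mul]
      · simp [hi]
end

section
/- Let 1 ≤ c_1 ≤ n_1 − 1 and 1 ≤ c_2 ≤ n_2 − 1. If X_1 ⊆ ℂ^{n_1} is positively hyperbolic of codimension c_1 and X_2 ⊆ ℂ^{n_2} is positively hyperbolic of codimension c_2, then the product X_1 × X_2 = {(x_1, x_2) : x_1 ∈ X_1, x_2 ∈ X_2} ⊆ ℂ^{n_1 + n_2} is positively hyperbolic of codimension c_1 + c_2. -/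
open Matrix

/-- `v` has `d + 1` entries, at increasing positions, whose signs weakly alternate. -/
def WeaklyAlternates {n : ℕ} (v : Fin n → ℝ) (d : ℕ) : Prop :=
  ∃ s : ℕ → Fin n, (∀ i j, i < j → j ≤ d → s i < s j) ∧
    ∃ ε : ℝ, ε ≠ 0 ∧ ∀ i ≤ d, 0 ≤ ε * (-1) ^ i * v (s i)

theorem WeaklyAlternates.zero {n d : ℕ} (h : d < n) :
    WeaklyAlternates (0 : Fin n → ℝ) d := by
  have : NeZero n := ⟨by omega⟩
  refine ⟨fun i => Fin.ofNat n i, fun i j hij hj => ?_, 1, one_ne_zero, by simp⟩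
  rw [Fin.lt_def]
  simp only [Fin.ofNat]
  rwa [Nat.mod_eq_of_lt (by omega), Nat.mod_eq_of_lt (by omega)]

theorem WeaklyAlternates.append {n₁ n₂ d₁ d₂ : ℕ} {v₁ : Fin n₁ → ℝ} {v₂ : Fin n₂ → ℝ}
    (h₁ : WeaklyAlternates v₁ d₁) (h₂ : WeaklyAlternates v₂ d₂) :
    WeaklyAlternates (Fin.append v₁ v₂) (d₁ + d₂) := by
  obtain ⟨s₁, hs₁, ε₁, hε₁, ha₁⟩ := h₁
  obtain ⟨s₂, hs₂, ε₂, hε₂, ha₂⟩ := h₂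
  -- The shift `k` is `0` if the second sequence continues the signs of the first one
  -- after dropping its first entry, and `1` if it does so without dropping.
  have key : ∀ k : ℕ, k ≤ 1 → 0 < ε₂ * (ε₁ * (-1) ^ (d₁ + k)) →
      WeaklyAlternates (Fin.append v₁ v₂) (d₁ + d₂) := by
    intro k hk hpos
    refine ⟨fun i => if i ≤ d₁ then Fin.castAdd n₂ (s₁ i) else Fin.natAdd n₁ (s₂ (i - d₁ - k)),
      fun i j hij hj => ?_, ε₁, hε₁, fun i hi => ?_⟩
    · by_cases hjd : j ≤ d₁
      · have hid : i ≤ d₁ := by omega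
        simpa only [hjd, hid, if_true, Fin.lt_def, Fin.val_castAdd] using hs₁ i j hij hjd
      · by_cases hid : i ≤ d₁
        · simp only [hid, hjd, if_true, if_false, Fin.lt_def, Fin.val_castAdd, Fin.val_natAdd]
          have := (s₁ i).isLt
          omega
        · simpa [hjd, hid] using hs₂ (i - d₁ - k) (j - d₁ - k) (by omega) (by omega)
    · by_cases hid : i ≤ d₁
      · simpa [hid] using ha₁ i hid
      · obtain ⟨m, rfl⟩ : ∃ m, i = d₁ + k + m := ⟨i - d₁ - k, by omega⟩
        have hm : d₁ + k + m - d₁ - k = m := by omega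
        simp only [hid, if_false, hm, Fin.append_right]
        have h := mul_nonneg hpos.le (ha₂ m (by omega))
        have h' : 0 ≤ ε₂ ^ 2 * (ε₁ * (-1) ^ (d₁ + k + m) * v₂ (s₂ m)) := by
          rw [pow_add]
          linarith
        exact nonneg_of_mul_nonneg_right h' (by positivity)
  have hne : ε₂ * (ε₁ * (-1) ^ d₁) ≠ 0 := by simp [hε₁, hε₂]
  rcases hne.lt_or_gt with h | h
  · exact key 1 le_rfl (by rw [pow_succ]; linarith)
  · exact key 0 zero_le_one (by simpa using h)

/-- If `v` is a nonzero vector of a positive `c`-dimensional subspace, then it has at most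
`c - 1` weak sign changes. -/
theorem IsPositiveSubspace.not_weaklyAlternates {n c : ℕ} {L : Submodule ℝ (Fin n → ℝ)}
    (hL : IsPositiveSubspace c L) {v : Fin n → ℝ} (hv : v ∈ L) (hv0 : v ≠ 0) :
    ¬ WeaklyAlternates v c := by
  rintro ⟨s, hs, ε, hε, ha⟩
  obtain ⟨A, -, rfl, hA⟩ := hL
  obtain ⟨x, rfl⟩ := (Submodule.mem_span_range_iff_exists_fun ℝ).1 hv
  have hxv : ∑ i, x i • A i = x ᵥ* A := (Matrix.vecMul_eq_sum x A).symm
  rw [hxv] at ha hv0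
  let t : Fin (c + 1) → Fin n := fun i => s i
  have ht : StrictMono t := fun i j hij => hs i j hij (by omega)
  let B : Matrix (Fin (c + 1)) (Fin (c + 1)) ℝ :=
    Matrix.of (Fin.cons (fun j => (x ᵥ* A) (t j)) fun i j => A i (t j))
  have hB : B.det = 0 := by
    refine Matrix.exists_vecMul_eq_zero_iff.1 ⟨Fin.cons (-1) x, fun h => ?_, ?_⟩
    · simpa using congrFun h 0
    · ext j
      simp [B, Matrix.vecMul, dotProduct, Fin.sum_univ_succ]
  have hminor : ∀ j : Fin (c + 1), 0 < (A.submatrix id (t ∘ j.succAbove)).det := fun j =>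
    hA _ (ht.comp (Fin.strictMono_succAbove j))
  have hsum : ∑ j : Fin (c + 1),
      ε * (-1) ^ (j : ℕ) * (x ᵥ* A) (t j) * (A.submatrix id (t ∘ j.succAbove)).det = 0 := by
    rw [Matrix.det_succ_row_zero] at hB
    have := congrArg (ε * ·) hB
    simp only [mul_zero, Finset.mul_sum] at this
    rw [← this]
    refine Finset.sum_congr rfl fun j _ => ?_
    have : B.submatrix Fin.succ j.succAbove = A.submatrix id (t ∘ j.succAbove) := by
      ext i k
      simp [B]
    rw [this]
    simp only [B, Matrix.of_apply, Fin.cons_zero]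
    ring
  have hzero : ∀ j : Fin (c + 1), (x ᵥ* A) (t j) = 0 := fun j => by
    have h := (Finset.sum_eq_zero_iff_of_nonneg fun (j : Fin (c + 1)) _ =>
      mul_nonneg (ha j (by omega)) (hminor j).le).1 hsum j (Finset.mem_univ j)
    simpa [hε, (hminor j).ne'] using h
  have hx : x = 0 := by
    refine Matrix.eq_zero_of_vecMul_eq_zero (hminor 0).ne' ?_
    ext k
    exact hzero _
  exact hv0 (by simp [hx])

open Polynomial in
/-- A nonzero vector with exactly `d` weak sign changes has the signs of a polynomial of degree
`d` at `0, 1, …, n - 1`. -/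
theorem exists_polynomial_sign_eq {n : ℕ} {v : Fin n → ℝ} (hv : v ≠ 0) :
    ∃ (p : ℝ[X]) (d : ℕ), p.natDegree ≤ d ∧ WeaklyAlternates v d ∧
      ∀ i : Fin n, ∃ q : ℝ, 0 < q ∧ v i = q * p.eval (i : ℝ) := by
  have main : ∀ m ≤ n, (∀ i : Fin n, i.val < m → v i = 0) ∨
      ∃ (p : ℝ[X]) (d : ℕ) (s : ℕ → Fin n) (ε : ℝ), p.natDegree ≤ d ∧
        (∀ i j, i < j → j ≤ d → s i < s j) ∧ (∀ i ≤ d, (s i).val < m) ∧ ε ≠ 0 ∧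
        (∀ i ≤ d, 0 ≤ ε * (-1) ^ i * v (s i)) ∧
        (∀ y : ℝ, (m : ℝ) - 1 < y → 0 < ε * (-1) ^ d * p.eval y) ∧
        ∀ i : Fin n, i.val < m → ∃ q : ℝ, 0 < q ∧ v i = q * p.eval (i : ℝ) := by
    intro m
    induction m with
    | zero => exact fun _ => Or.inl fun i hi => absurd hi (by omega)
    | succ m ih =>
      intro hm
      let k : Fin n := ⟨m, hm⟩
      have hk : ∀ i : Fin n, i.val < m + 1 → i.val < m ∨ i = k := fun i hi =>
        (Nat.lt_succ_iff_lt_or_eq.1 hi).imp id Fin.ext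
      rcases ih (by omega) with h0 | ⟨p, d, s, ε, hd, hs, hsm, hε, ha, hp, hq⟩
      · by_cases hvk : v k = 0
        · exact Or.inl fun i hi => (hk i hi).elim (h0 i) fun h => h ▸ hvk
        have hroots : ∀ y : ℝ, (m : ℝ) - 1 < y → 0 < ∏ i ∈ Finset.range m, (y - i) := by
          intro y hy
          refine Finset.prod_pos fun i hi => ?_
          have : (i : ℝ) + 1 ≤ m := by exact_mod_cast Finset.mem_range.1 hi
          linarith
        have : NeZero n := ⟨by omega⟩
        refine Or.inr ⟨C (v k) * ∏ i ∈ Finset.range m, (X - C (i : ℝ)), m, Fin.ofNat n,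
          v k * (-1) ^ m, ?_, ?_, ?_, by simp [hvk], ?_, ?_, ?_⟩
        · refine (natDegree_C_mul_le _ _).trans ?_
          rw [natDegree_finsetProd_X_sub_C_eq_card, Finset.card_range]
        · intro i j hij hj
          rw [Fin.lt_def]
          simp only [Fin.ofNat]
          rwa [Nat.mod_eq_of_lt (by omega), Nat.mod_eq_of_lt (by omega)]
        · intro i hi
          simp only [Fin.ofNat]
          rw [Nat.mod_eq_of_lt (by omega)]
          omega
        · intro i hi
          rcases hi.lt_or_eq with hi | rfl
          · rw [h0 (Fin.ofNat n i), mul_zero]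
            simp only [Fin.ofNat]
            rwa [Nat.mod_eq_of_lt (by omega)]
          · have : Fin.ofNat n i = k := Fin.ext (Nat.mod_eq_of_lt hm)
            rw [this, mul_assoc (v k), ← mul_pow]
            norm_num
            exact mul_self_nonneg _
        · intro y hy
          have hy' := hroots y (by push_cast at hy; linarith)
          have h1 : ((-1 : ℝ) ^ m) * (-1) ^ m = 1 := by rw [← mul_pow]; norm_num
          rw [mul_assoc (v k), h1, eval_mul, eval_prod]
          simp only [eval_C, eval_sub, eval_X, mul_one]
          rw [← mul_assoc]
          exact mul_pos (mul_self_pos.2 hvk) hy'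
        · intro i hi
          rcases hk i hi with hi | rfl
          · refine ⟨1, one_pos, ?_⟩
            rw [h0 i hi, eval_mul, eval_prod,
              Finset.prod_eq_zero (Finset.mem_range.2 hi) (by simp)]
            simp
          · have := hroots m (by linarith)
            refine ⟨(∏ i ∈ Finset.range m, ((m : ℝ) - i))⁻¹, inv_pos.2 this, ?_⟩
            simp only [eval_mul, eval_prod, eval_C, eval_sub, eval_X, k]
            field_simp
      · right
        -- Add a root `r` when the sign does not persist at the new position.
        have step : ∀ r : ℝ, (m : ℝ) - 1 < r → r ≤ m →
            0 ≤ ε * (-1) ^ (d + 1) * v k →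
            (∃ q : ℝ, 0 < q ∧ v k = q * (p * (C r - X)).eval (m : ℝ)) →
            ∃ (p : ℝ[X]) (d : ℕ) (s : ℕ → Fin n) (ε : ℝ), p.natDegree ≤ d ∧
            (∀ i j, i < j → j ≤ d → s i < s j) ∧ (∀ i ≤ d, (s i).val < m + 1) ∧ ε ≠ 0 ∧
            (∀ i ≤ d, 0 ≤ ε * (-1) ^ i * v (s i)) ∧
            (∀ y : ℝ, ((m + 1 : ℕ) : ℝ) - 1 < y → 0 < ε * (-1) ^ d * p.eval y) ∧
            ∀ i : Fin n, i.val < m + 1 → ∃ q : ℝ, 0 < q ∧ v i = q * p.eval (i : ℝ) := by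
          intro r hr hrm hvk hqk
          refine ⟨p * (C r - X), d + 1, fun i => if i ≤ d then s i else k, ε, ?_, ?_, ?_, hε,
            ?_, ?_, ?_⟩
          · refine natDegree_mul_le.trans (add_le_add hd ?_)
            refine (natDegree_sub_le _ _).trans ?_
            simp
          · intro i j hij hj
            have hid : i ≤ d := by omega
            by_cases hjd : j ≤ d
            · simpa [hid, hjd] using hs i j hij hjd
            · simpa [hid, hjd, Fin.lt_def, k] using hsm i hid
          · intro i hi
            by_cases hid : i ≤ d
            · simpa [hid] using (hsm i hid).trans (Nat.lt_succ_self m)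
            · simp [hid, k]
          · intro i hi
            by_cases hid : i ≤ d
            · simpa [hid] using ha i hid
            · obtain rfl : i = d + 1 := by omega
              simpa using hvk
          · intro y hy
            push_cast at hy
            have h := mul_pos (hp y (by linarith)) (show 0 < y - r by linarith)
            simp only [eval_mul, eval_sub, eval_C, eval_X, pow_succ]
            linarith
          · intro i hi
            rcases hk i hi with hi | rfl
            · obtain ⟨q, hq0, hqi⟩ := hq i hi
              have : (i : ℝ) + 1 ≤ m := by exact_mod_cast hi
              have hri : 0 < r - i := by linarith
              refine ⟨q / (r - i), div_pos hq0 hri, ?_⟩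
              simp only [eval_mul, eval_sub, eval_C, eval_X]
              rw [hqi]
              field_simp
            · exact hqk
        have hpm := hp m (by linarith)
        have hsq : ε * (-1) ^ d ≠ 0 := by simp [hε]
        have hpm0 : p.eval (m : ℝ) ≠ 0 := fun h => by simp [h] at hpm
        rcases lt_trichotomy (ε * (-1) ^ d * v k) 0 with hlt | heq | hgt
        · refine step (m - 1 / 2) (by linarith) (by linarith)
            (by rw [pow_succ]; linarith) ⟨-2 * (v k / p.eval (m : ℝ)), ?_, ?_⟩
          · have h : v k / p.eval (m : ℝ) < 0 := by
              rw [← mul_div_mul_left _ _ hsq]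
              exact div_neg_of_neg_of_pos hlt hpm
            linarith
          · simp only [eval_mul, eval_sub, eval_C, eval_X]
            field_simp
            ring
        · have hvk : v k = 0 := by simpa [hε] using heq
          exact step m (by linarith) le_rfl (by simp [hvk]) ⟨1, one_pos, by simp [hvk]⟩
        · refine ⟨p, d, s, ε, hd, hs, fun i hi => (hsm i hi).trans (Nat.lt_succ_self m), hε, ha,
            fun y hy => hp y (by push_cast at hy; linarith), fun i hi => ?_⟩
          rcases hk i hi with hi | rfl
          · exact hq i hi
          · refine ⟨v k / p.eval (m : ℝ), ?_, ?_⟩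
            · rw [← mul_div_mul_left _ _ hsq]
              exact div_pos hgt hpm
            · simp only [k]
              field_simp
  rcases main n le_rfl with h | ⟨p, d, s, ε, hd, hs, -, hε, ha, -, hq⟩
  · exact absurd (funext fun i => h i i.isLt) hv
  · exact ⟨p, d, hd, ⟨s, hs, ε, hε, ha⟩, fun i => hq i i.isLt⟩

theorem WeaklyAlternates.mono {n d e : ℕ} {v : Fin n → ℝ} (h : WeaklyAlternates v d)
    (hed : e ≤ d) : WeaklyAlternates v e := by
  obtain ⟨s, hs, ε, hε, ha⟩ := h
  exact ⟨s, fun i j hij hj => hs i j hij (hj.trans hed), ε, hε, fun i hi => ha i (hi.trans hed)⟩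

/-- The moment curve at `0, 1, …, n - 1`, rescaled by positive weights, spans a positive
subspace. -/
theorem isPositiveSubspace_span_weighted_vandermonde {n c : ℕ} (hc : c ≤ n) {q : Fin n → ℝ}
    (hq : ∀ j, 0 < q j) :
    IsPositiveSubspace c (Submodule.span ℝ
      (Set.range fun (i : Fin c) (j : Fin n) => q j * (j : ℝ) ^ (i : ℕ))) := by
  let A : Matrix (Fin c) (Fin n) ℝ := Matrix.of fun i j => q j * (j : ℝ) ^ (i : ℕ)
  have hA : AllMinorsPos A := by
    intro s hs
    have h : A.submatrix id s = Matrix.of fun i j =>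
        q (s j) * (Matrix.vandermonde fun j => ((s j : ℕ) : ℝ))ᵀ i j := by
      ext i j
      simp [A, Matrix.vandermonde]
    rw [h, Matrix.det_mul_row, Matrix.det_transpose, Matrix.det_vandermonde]
    refine mul_pos (Finset.prod_pos fun i _ => hq _)
      (Finset.prod_pos fun i _ => Finset.prod_pos fun j hj => sub_pos.2 ?_)
    exact_mod_cast hs (Finset.mem_Ioi.1 hj)
  refine ⟨A, ?_, rfl, hA⟩
  refine le_antisymm (by simpa using A.rank_le_card_height) ?_
  have hdet := hA (Fin.castLE hc) (Fin.strictMono_castLE hc)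
  have hrank := Matrix.rank_of_isUnit _
    ((Matrix.isUnit_iff_isUnit_det _).2 (isUnit_iff_ne_zero.2 hdet.ne'))
  rw [Fintype.card_fin] at hrank
  exact hrank.symm.le.trans (Matrix.rank_submatrix_le _ _ _)

/-- A nonzero vector with at most `c - 1` weak sign changes lies in a positive `c`-dimensional
subspace. -/
theorem exists_isPositiveSubspace_mem {n c : ℕ} (hc : c ≤ n) {v : Fin n → ℝ} (hv : v ≠ 0)
    (h : ¬ WeaklyAlternates v c) : ∃ L, IsPositiveSubspace c L ∧ v ∈ L := by
  obtain ⟨p, d, hd, halt, hp⟩ := exists_polynomial_sign_eq hv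
  choose q hq hvq using hp
  have hdc : d < c := lt_of_not_ge fun hcd => h (halt.mono hcd)
  refine ⟨_, isPositiveSubspace_span_weighted_vandermonde hc hq,
    (Submodule.mem_span_range_iff_exists_fun ℝ).2 ⟨fun i => p.coeff i, ?_⟩⟩
  ext j
  rw [hvq j, Polynomial.eval_eq_sum_range' (hd.trans_lt hdc), ← Fin.sum_univ_eq_sum_range
    (fun i => p.coeff i * (j : ℝ) ^ i), Finset.mul_sum]
  simp only [Finset.sum_apply, Pi.smul_apply, smul_eq_mul]
  exact Finset.sum_congr rfl fun i _ => by ring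

/-- The imaginary part of any point of a positively hyperbolic set of codimension `c` is zero or
has at least `c` weak sign changes. -/
theorem PosHyperbolic.weaklyAlternates {n c : ℕ} (hc : c < n) {X : Set (Fin n → ℂ)}
    (hX : PosHyperbolic c X) {x : Fin n → ℂ} (hx : x ∈ X) : WeaklyAlternates (imPart x) c := by
  by_contra h
  by_cases h0 : imPart x = 0
  · exact h (h0 ▸ WeaklyAlternates.zero hc)
  · obtain ⟨L, hL, hxL⟩ := exists_isPositiveSubspace_mem hc.le h0 h
    exact hX L hL x hx ⟨hxL, h0⟩

/-- The product of a positively hyperbolic set of codimension `c₁` in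
`ℂ^{n₁}` and a positively hyperbolic set of codimension `c₂` in `ℂ^{n₂}` is positively
hyperbolic of codimension `c₁ + c₂` in `ℂ^{n₁+n₂}`. -/
theorem stmt9 {n₁ n₂ c₁ c₂ : ℕ} (h₁ : 1 ≤ c₁) (h₁' : c₁ ≤ n₁ - 1)
    (h₂ : 1 ≤ c₂) (h₂' : c₂ ≤ n₂ - 1)
    (X₁ : Set (Fin n₁ → ℂ)) (X₂ : Set (Fin n₂ → ℂ))
    (hX₁ : PosHyperbolic c₁ X₁) (hX₂ : PosHyperbolic c₂ X₂) :
    PosHyperbolic (c₁ + c₂)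
      {z : Fin (n₁ + n₂) → ℂ | ∃ x₁ ∈ X₁, ∃ x₂ ∈ X₂, z = Fin.append x₁ x₂} := by
  rintro L hL _ ⟨x₁, hx₁, x₂, hx₂, rfl⟩ ⟨hmem, hne⟩
  have happ : imPart (Fin.append x₁ x₂) = Fin.append (imPart x₁) (imPart x₂) := by
    ext i
    refine Fin.addCases (fun i => ?_) (fun i => ?_) i <;> simp [imPart]
  refine hL.not_weaklyAlternates hmem hne ?_
  rw [happ]
  exact (hX₁.weaklyAlternates (by omega) hx₁).append (hX₂.weaklyAlternates (by omega) hx₂)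
end
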